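/- arXiv:1004.3964 — 2 statements merged into one kernel-verified Lean document; each statement's English description precedes it below -/
import Mathlib

section
/- The number of 132-avoiding double simsun permutations in S_n equals the number of 213-avoiding double simsun permutations in S_n; both equal the n-th secondary structure number S_n. -/
/-- A permutation `σ ∈ S_n` is *simsun* if for every `k`, the subword of `σ`
restricted to the `k` smallest values has no double descent, i.e. no three
consecutive (in that subword) decreasing elements. -/
def Simsun {n : ℕ} (σ : Equiv.Perm (Fin n)) : Prop :=
  ∀ k : ℕ, ¬ ∃ i j l : Fin n, i < j ∧ j < l ∧
    (σ i).val < k ∧ (σ j).val < k ∧ (σ l).val < k ∧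
    σ l < σ j ∧ σ j < σ i ∧
    (∀ m : Fin n, i < m → m < j → k ≤ (σ m).val) ∧
    (∀ m : Fin n, j < m → m < l → k ≤ (σ m).val)

def DoubleSimsun {n : ℕ} (σ : Equiv.Perm (Fin n)) : Prop :=
  Simsun σ ∧ Simsun σ⁻¹

def Avoids123 {n : ℕ} (σ : Equiv.Perm (Fin n)) : Prop :=
  ¬ ∃ i j k : Fin n, i < j ∧ j < k ∧ σ i < σ j ∧ σ j < σ k

def Avoids132 {n : ℕ} (σ : Equiv.Perm (Fin n)) : Prop :=
  ¬ ∃ i j k : Fin n, i < j ∧ j < k ∧ σ i < σ k ∧ σ k < σ j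

def Avoids213 {n : ℕ} (σ : Equiv.Perm (Fin n)) : Prop :=
  ¬ ∃ i j k : Fin n, i < j ∧ j < k ∧ σ j < σ i ∧ σ i < σ k

def Avoids231 {n : ℕ} (σ : Equiv.Perm (Fin n)) : Prop :=
  ¬ ∃ i j k : Fin n, i < j ∧ j < k ∧ σ k < σ i ∧ σ i < σ j

def Avoids312 {n : ℕ} (σ : Equiv.Perm (Fin n)) : Prop :=
  ¬ ∃ i j k : Fin n, i < j ∧ j < k ∧ σ j < σ k ∧ σ k < σ i

def Avoids321 {n : ℕ} (σ : Equiv.Perm (Fin n)) : Prop :=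
  ¬ ∃ i j k : Fin n, i < j ∧ j < k ∧ σ k < σ j ∧ σ j < σ i

/-- An occurrence of the pattern 4132 at positions `i1 < i2 < i3 < i4`. -/
def Pattern4132At {n : ℕ} (σ : Equiv.Perm (Fin n)) (i1 i2 i3 i4 : Fin n) : Prop :=
  i1 < i2 ∧ i2 < i3 ∧ i3 < i4 ∧ σ i2 < σ i4 ∧ σ i4 < σ i3 ∧ σ i3 < σ i1

/-- An occurrence of the pattern 51342 at positions `j1 < j2 < j3 < j4 < j5`. -/
def Pattern51342At {n : ℕ} (σ : Equiv.Perm (Fin n)) (j1 j2 j3 j4 j5 : Fin n) : Prop :=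
  j1 < j2 ∧ j2 < j3 ∧ j3 < j4 ∧ j4 < j5 ∧
  σ j2 < σ j5 ∧ σ j5 < σ j3 ∧ σ j3 < σ j4 ∧ σ j4 < σ j1

/-- `σ` has no occurrence of the pattern 4132. -/
def No4132 {n : ℕ} (σ : Equiv.Perm (Fin n)) : Prop :=
  ¬ ∃ i1 i2 i3 i4 : Fin n, Pattern4132At σ i1 i2 i3 i4

/-- Every occurrence of the pattern 4132 in `σ` is contained in an occurrence
of the pattern 51342 (its four indices are among the five indices). -/
def Every4132In51342 {n : ℕ} (σ : Equiv.Perm (Fin n)) : Prop :=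
  ∀ i1 i2 i3 i4 : Fin n, Pattern4132At σ i1 i2 i3 i4 →
    ∃ j1 j2 j3 j4 j5 : Fin n, Pattern51342At σ j1 j2 j3 j4 j5 ∧
      ({i1, i2, i3, i4} : Set (Fin n)) ⊆ ({j1, j2, j3, j4, j5} : Set (Fin n))

def Contains35142 {n : ℕ} (σ : Equiv.Perm (Fin n)) : Prop :=
  ∃ i1 i2 i3 i4 i5 : Fin n, i1 < i2 ∧ i2 < i3 ∧ i3 < i4 ∧ i4 < i5 ∧
    σ i3 < σ i5 ∧ σ i5 < σ i1 ∧ σ i1 < σ i4 ∧ σ i4 < σ i2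

def Contains42513 {n : ℕ} (σ : Equiv.Perm (Fin n)) : Prop :=
  ∃ i1 i2 i3 i4 i5 : Fin n, i1 < i2 ∧ i2 < i3 ∧ i3 < i4 ∧ i4 < i5 ∧
    σ i4 < σ i2 ∧ σ i2 < σ i5 ∧ σ i5 < σ i1 ∧ σ i1 < σ i3

/-- A Motzkin path encoded as a list of steps `1` (up), `-1` (down), `0` (level):
all prefix sums are nonnegative and the total sum is zero. -/
def MotzkinPath (p : List ℤ) : Prop :=
  (∀ s ∈ p, s = 1 ∨ s = -1 ∨ s = 0) ∧ (∀ t : List ℤ, t <+: p → 0 ≤ t.sum) ∧ p.sum = 0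

/-- The path has no two consecutive up steps. -/
def UUFree (p : List ℤ) : Prop := ¬ ([1, 1] : List ℤ) <:+: p

-- The number of descents of a permutation
open scoped Classical in
noncomputable def numDescents {n : ℕ} (σ : Equiv.Perm (Fin n)) : ℕ :=
  (Finset.univ.filter fun i : Fin n =>
    ∃ h : i.val + 1 < n, σ ⟨i.val + 1, h⟩ < σ i).card

/-- `τ_1 > τ_2 < τ_3 > τ_4 < ⋯` (indices are 0-based here). -/
def Alternating {m : ℕ} (τ : Equiv.Perm (Fin m)) : Prop :=
  ∀ i : Fin m, ∀ h : i.val + 1 < m,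
    if i.val % 2 = 0 then τ ⟨i.val + 1, h⟩ < τ i else τ i < τ ⟨i.val + 1, h⟩

namespace SimsunTree

/-- Unlabelled binary trees; `node L R` encodes a permutation that is the skew sum of the
permutation of `L` and of the permutation of `R` with one extra corner point. -/
inductive Shape
  | leaf : Shape
  | node : Shape → Shape → Shape

namespace Shape

/-- The number of internal nodes. -/
def size : Shape → ℕ
  | leaf => 0
  | node L R => size L + size R + 1

/-- The shapes of permutations none of whose restrictions to small values ends with a descent. -/
def EndOk : Shape → Prop
  | leaf => True
  | node L R => EndOk R ∧ (L ≠ leaf → R ≠ leaf)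

/-- The shapes of permutations whose inverses have no restriction to small values that ends
with a descent. -/
def InvEndOk : Shape → Prop
  | leaf => True
  | node L R => (L = leaf → InvEndOk R) ∧ (L ≠ leaf → InvEndOk L ∧ L ≠ node leaf leaf)

/-- The shapes of double simsun permutations. -/
def Good : Shape → Prop
  | leaf => True
  | node L R => Good L ∧ Good R ∧ (L ≠ leaf → EndOk L ∧ InvEndOk R)

/-- Adds a node at the end of the right spine. -/
def dup : Shape → Shape
  | leaf => node leaf leaf
  | node L R => node L (dup R)

/-- The counterpart of `dup` for the inverse permutation. -/
def invDup : Shape → Shape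
  | leaf => node leaf leaf
  | node leaf R => node leaf (invDup R)
  | node (node A B) R => node (invDup (node A B)) R

theorem size_dup (t : Shape) : t.dup.size = t.size + 1 := by
  induction t with
  | leaf => rfl
  | node L R _ ihR => simp only [dup, size, ihR]; omega

theorem size_invDup (t : Shape) : t.invDup.size = t.size + 1 := by
  fun_induction invDup t with
  | case1 => rfl
  | case2 R ih => simp only [size, ih]; omega
  | case3 A B R ih => rw [size, ih]; simp only [size]; omega

theorem dup_ne_leaf (t : Shape) : t.dup ≠ leaf := by
  cases t <;> simp [dup]

theorem invDup_ne_leaf (t : Shape) : t.invDup ≠ leaf := by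
  fun_cases invDup t <;> simp

theorem dup_injective : Function.Injective dup := by
  intro s
  induction s with
  | leaf =>
    intro t h
    cases t with
    | leaf => rfl
    | node L R =>
      simp only [dup, node.injEq] at h
      exact absurd h.2.symm (dup_ne_leaf R)
  | node A B _ ih =>
    intro t h
    cases t with
    | leaf => simp [dup, dup_ne_leaf] at h
    | node L R =>
      simp only [dup, node.injEq] at h
      rw [h.1, ih h.2]

theorem invDup_injective : Function.Injective invDup := by
  intro s
  fun_induction invDup s with
  | case1 =>
    intro t h
    fun_cases invDup t <;> grind [invDup, invDup_ne_leaf]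
  | case2 R ih =>
    intro t h
    fun_cases invDup t <;> grind [invDup, invDup_ne_leaf]
  | case3 A B R ih =>
    intro t h
    fun_cases invDup t <;> grind [invDup, invDup_ne_leaf]

theorem endOk_dup (t : Shape) : t.dup.EndOk := by
  induction t with
  | leaf => simp [dup, EndOk]
  | node L R _ ih => exact ⟨ih, fun _ => dup_ne_leaf R⟩

theorem invEndOk_dup_iff (t : Shape) : t.dup.InvEndOk ↔ t.InvEndOk := by
  induction t with
  | leaf => simp [dup, InvEndOk]
  | node L R _ ih => simp [dup, InvEndOk, ih]

theorem good_dup_iff (t : Shape) : t.dup.Good ↔ t.Good := by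
  induction t with
  | leaf => simp [dup, Good]
  | node L R _ ih => simp [dup, Good, ih, invEndOk_dup_iff]

theorem invEndOk_invDup (t : Shape) : t.invDup.InvEndOk := by
  fun_induction invDup t with
  | case1 => simp [InvEndOk]
  | case2 R ih => simpa [InvEndOk] using ih
  | case3 A B R ih =>
    refine ⟨fun h => absurd h (invDup_ne_leaf _), fun _ => ⟨ih, fun h => ?_⟩⟩
    have := size_invDup (node A B)
    rw [h] at this
    simp only [size] at this
    omega

theorem endOk_invDup_iff (t : Shape) : t.invDup.EndOk ↔ t.EndOk := by
  fun_induction invDup t with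
  | case1 => simp [EndOk]
  | case2 R ih => simp [EndOk, ih]
  | case3 A B R ih => simp [EndOk, invDup_ne_leaf]

theorem good_invDup_iff (t : Shape) : t.invDup.Good ↔ t.Good := by
  fun_induction invDup t with
  | case1 => simp [Good]
  | case2 R ih => simp [Good, ih]
  | case3 A B R ih =>
    rw [Good, Good, ih, endOk_invDup_iff]
    simp [invDup_ne_leaf]

theorem exists_dup_eq {t : Shape} (h : t.EndOk) (hne : t ≠ leaf) : ∃ s : Shape, s.dup = t := by
  induction t with
  | leaf => exact absurd rfl hne
  | node L R _ ih =>
    by_cases hR : R = leaf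
    · have hL : L = leaf := by_contra fun hL => h.2 hL hR
      exact ⟨leaf, by rw [hL, hR, dup]⟩
    · obtain ⟨s, rfl⟩ := ih h.1 hR
      exact ⟨node L s, rfl⟩

theorem exists_invDup_eq {t : Shape} (h : t.InvEndOk) (hne : t ≠ leaf) :
    ∃ s : Shape, s.invDup = t := by
  induction t with
  | leaf => exact absurd rfl hne
  | node L R ihL ihR =>
    by_cases hL : L = leaf
    · subst hL
      by_cases hR : R = leaf
      · exact ⟨leaf, by rw [hR, invDup]⟩
      · obtain ⟨s, rfl⟩ := ihR (h.1 rfl) hR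
        exact ⟨node leaf s, rfl⟩
    · obtain ⟨s, rfl⟩ := ihL (h.2 hL).1 hL
      cases s with
      | leaf => exact absurd rfl (h.2 hL).2
      | node A B => exact ⟨node (node A B) R, rfl⟩

end Shape

/-- Motzkin paths without two consecutive up steps, parsed by first return: the empty path,
`F w`, `U D w` and `U F v D w`. -/
inductive Word
  | nil : Word
  | flat : Word → Word
  | peak : Word → Word
  | arch : Word → Word → Word

namespace Word

/-- The length of the path. -/
def length : Word → ℕ
  | nil => 0
  | flat w => length w + 1
  | peak w => length w + 2
  | arch v w => length v + length w + 3

/-- The shape of the double simsun permutation attached to a path. -/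
def toShape : Word → Shape
  | nil => .leaf
  | flat w => .node .leaf (toShape w)
  | peak w => .node (toShape w).dup .leaf
  | arch v w => .node (toShape w).dup (toShape v).invDup

/-- The list of steps of a path. -/
def toList : Word → List ℤ
  | nil => []
  | flat w => 0 :: toList w
  | peak w => 1 :: -1 :: toList w
  | arch v w => 1 :: 0 :: (toList v ++ -1 :: toList w)

theorem size_toShape (w : Word) : w.toShape.size = w.length := by
  induction w with
  | nil => rfl
  | flat w ih => simp only [toShape, Shape.size, length, ih]; omega
  | peak w ih => simp only [toShape, Shape.size, Shape.size_dup, length, ih]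
  | arch v w ihv ihw =>
    simp only [toShape, Shape.size, Shape.size_dup, Shape.size_invDup, length, ihv, ihw]; omega

theorem good_toShape (w : Word) : w.toShape.Good := by
  induction w with
  | nil => trivial
  | flat w ih => simpa [toShape, Shape.Good] using ih
  | peak w ih =>
    exact ⟨(Shape.good_dup_iff _).2 ih, trivial, fun _ => ⟨Shape.endOk_dup _, trivial⟩⟩
  | arch v w ihv ihw =>
    exact ⟨(Shape.good_dup_iff _).2 ihw, (Shape.good_invDup_iff _).2 ihv,
      fun _ => ⟨Shape.endOk_dup _, Shape.invEndOk_invDup _⟩⟩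

theorem toShape_injective : Function.Injective toShape := by
  intro v
  induction v with
  | nil => intro w h; cases w <;> simp_all [toShape]
  | flat v ih =>
    intro w h
    cases w <;> simp only [toShape, Shape.node.injEq, reduceCtorEq] at h
    · rw [ih h.2]
    · exact absurd h.1.symm (Shape.dup_ne_leaf _)
    · exact absurd h.1.symm (Shape.dup_ne_leaf _)
  | peak v ih =>
    intro w h
    cases w <;> simp only [toShape, Shape.node.injEq, reduceCtorEq] at h
    · exact absurd h.1 (Shape.dup_ne_leaf _)
    · rw [ih (Shape.dup_injective h.1)]
    · exact absurd h.2.symm (Shape.invDup_ne_leaf _)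
  | arch u v ihu ihv =>
    intro w h
    cases w <;> simp only [toShape, Shape.node.injEq, reduceCtorEq] at h
    · exact absurd h.1 (Shape.dup_ne_leaf _)
    · exact absurd h.2 (Shape.invDup_ne_leaf _)
    · rw [ihu (Shape.invDup_injective h.2), ihv (Shape.dup_injective h.1)]

theorem exists_toShape_eq (t : Shape) (ht : t.Good) : ∃ w : Word, w.toShape = t := by
  induction hn : t.size using Nat.strong_induction_on generalizing t with
  | _ n ih =>
    subst hn
    cases t with
    | leaf => exact ⟨nil, rfl⟩
    | node L R =>
      obtain ⟨hL, hR, hLR⟩ := ht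
      by_cases hl : L = .leaf
      · obtain ⟨w, rfl⟩ := ih R.size (by simp only [Shape.size]; omega) R hR rfl
        exact ⟨flat w, by rw [hl, toShape]⟩
      · obtain ⟨L', rfl⟩ := Shape.exists_dup_eq (hLR hl).1 hl
        obtain ⟨w, rfl⟩ := ih L'.size (by simp only [Shape.size, Shape.size_dup]; omega) L'
          ((Shape.good_dup_iff _).1 hL) rfl
        by_cases hr : R = .leaf
        · exact ⟨peak w, by rw [hr, toShape]⟩
        · obtain ⟨R', rfl⟩ := Shape.exists_invDup_eq (hLR hl).2 hr
          obtain ⟨v, rfl⟩ := ih R'.size (by simp only [Shape.size, Shape.size_invDup]; omega) R'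
            ((Shape.good_invDup_iff _).1 hR) rfl
          exact ⟨arch v w, rfl⟩

theorem length_toList (w : Word) : w.toList.length = w.length := by
  induction w with
  | nil => rfl
  | flat w ih => simp [toList, length, ih]
  | peak w ih => simp [toList, length, ih]
  | arch v w ihv ihw => simp only [toList, length, List.length_cons, List.length_append, ihv, ihw]; omega

end Word

theorem uuFree_cons_iff (a : ℤ) (p : List ℤ) :
    UUFree (a :: p) ↔ UUFree p ∧ ¬ (a = 1 ∧ p.head? = some 1) := by
  unfold UUFree
  rw [List.infix_cons_iff, List.cons_prefix_cons, not_or]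
  cases p with
  | nil => simp [and_comm]
  | cons b q => simp [List.cons_prefix_cons, and_comm, eq_comm]

theorem uuFree_append_down_iff (p q : List ℤ) :
    UUFree (p ++ -1 :: q) ↔ UUFree p ∧ UUFree q := by
  induction p with
  | nil => simp [uuFree_cons_iff, show UUFree [] by simp [UUFree]]
  | cons a p ih =>
    rw [List.cons_append, uuFree_cons_iff, uuFree_cons_iff, ih]
    cases p <;> simp
    tauto

theorem partial_sums_cons_iff (h a : ℤ) (p : List ℤ) :
    (∀ t : List ℤ, t <+: a :: p → 0 ≤ h + t.sum) ↔
      0 ≤ h ∧ ∀ t : List ℤ, t <+: p → 0 ≤ h + a + t.sum := by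
  constructor
  · intro H
    refine ⟨by simpa using H [] (by simp), fun t ht => ?_⟩
    simpa [add_assoc] using H (a :: t) (List.cons_prefix_cons.2 ⟨rfl, ht⟩)
  · rintro ⟨h0, H⟩ t ht
    rcases List.prefix_cons_iff.1 ht with rfl | ⟨t', rfl, ht'⟩
    · simpa using h0
    · simpa [add_assoc] using H t' ht'

theorem partial_sums_append_iff (h : ℤ) (p q : List ℤ) :
    (∀ t : List ℤ, t <+: p ++ q → 0 ≤ h + t.sum) ↔
      (∀ t : List ℤ, t <+: p → 0 ≤ h + t.sum) ∧
        ∀ t : List ℤ, t <+: q → 0 ≤ h + p.sum + t.sum := by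
  induction p generalizing h with
  | nil =>
    simp only [List.nil_append, List.prefix_nil, forall_eq, List.sum_nil, add_zero]
    exact ⟨fun H => ⟨by simpa using H [] (by simp), H⟩, fun H => H.2⟩
  | cons a p ih =>
    rw [List.cons_append, partial_sums_cons_iff, partial_sums_cons_iff, ih, List.sum_cons, and_assoc]
    simp only [add_assoc]

/-- First passage of a lattice path below level `0`. -/
theorem exists_first_passage (p : List ℤ) (hp : ∀ s ∈ p, s = 1 ∨ s = -1 ∨ s = 0) (h : ℤ)
    (h0 : 0 ≤ h) (hs : h + p.sum < 0) :
    ∃ q r : List ℤ, p = q ++ -1 :: r ∧ h + q.sum = 0 ∧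
      ∀ t : List ℤ, t <+: q → 0 ≤ h + t.sum := by
  induction p generalizing h with
  | nil => simp at hs; omega
  | cons a p ih =>
    simp only [List.mem_cons, forall_eq_or_imp, List.sum_cons] at hp hs
    by_cases ha : h + a < 0
    · exact ⟨[], p, by simp; omega, by simp; omega, by simpa using h0⟩
    · obtain ⟨q, r, rfl, hq, hq'⟩ := ih hp.2 (h + a) (by omega) (by omega)
      exact ⟨a :: q, r, rfl, by rw [List.sum_cons]; omega, (partial_sums_cons_iff _ _ _).2 ⟨h0, hq'⟩⟩

theorem motzkinPath_flat_iff (p : List ℤ) : MotzkinPath (0 :: p) ↔ MotzkinPath p := by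
  have := partial_sums_cons_iff 0 0 p
  simp only [zero_add, le_refl, true_and] at this
  simp [MotzkinPath, this]

theorem motzkinPath_arch {p q : List ℤ} (hp : MotzkinPath p) (hq : MotzkinPath q) :
    MotzkinPath (1 :: (p ++ -1 :: q)) := by
  obtain ⟨hp1, hp2, hp3⟩ := hp
  obtain ⟨hq1, hq2, hq3⟩ := hq
  refine ⟨?_, ?_, by simp [hp3, hq3]⟩
  · intro s hs
    simp only [List.mem_cons, List.mem_append] at hs
    rcases hs with h | h | h | h
    · exact .inl h
    · exact hp1 s h
    · exact .inr (.inl h)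
    · exact hq1 s h
  · have := (partial_sums_cons_iff 0 1 (p ++ -1 :: q)).2 ⟨le_rfl,
      (partial_sums_append_iff _ _ _).2 ⟨fun t ht => by linarith [hp2 t ht],
        (partial_sums_cons_iff _ _ _).2 ⟨by omega, fun t ht => by linarith [hq2 t ht]⟩⟩⟩
    simpa using this

theorem exists_arch_of_motzkinPath {p : List ℤ} (h : MotzkinPath (1 :: p)) :
    ∃ q r : List ℤ, p = q ++ -1 :: r ∧ MotzkinPath q ∧ MotzkinPath r := by
  obtain ⟨h1, h2, h3⟩ := h
  simp only [List.mem_cons, forall_eq_or_imp, List.sum_cons] at h1 h3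
  obtain ⟨q, r, rfl, hq, hq'⟩ := exists_first_passage p h1.2 0 le_rfl (by omega)
  refine ⟨q, r, rfl, ⟨fun s hs => h1.2 s (by simp [hs]), by simpa using hq', by omega⟩,
    fun s hs => h1.2 s (by simp [hs]), fun t ht => ?_, ?_⟩
  · have := h2 (1 :: (q ++ -1 :: t)) (by simpa [List.cons_prefix_cons] using ht)
    simp only [List.sum_cons, List.sum_append] at this
    omega
  · simp only [List.sum_cons, List.sum_append] at h3
    omega

theorem append_down_inj {p p' q q' : List ℤ} (hp : MotzkinPath p) (hp' : MotzkinPath p')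
    (h : p ++ -1 :: q = p' ++ -1 :: q') : p = p' ∧ q = q' := by
  have key : ∀ {p p' q q' : List ℤ}, MotzkinPath p → MotzkinPath p' →
      p ++ -1 :: q = p' ++ -1 :: q' → p'.length ≤ p.length := by
    intro p p' q q' hp hp' h
    by_contra! hlt
    have h1 : p ++ [-1] <+: p' := by
      refine List.prefix_of_prefix_length_le (l₃ := p' ++ -1 :: q') ⟨q, by simp [← h]⟩
        (List.prefix_append _ _) (by simpa using hlt)
    have := hp'.2.1 _ h1
    simp [hp.2.2] at this
  have := List.append_inj h (le_antisymm (key hp' hp h.symm) (key hp hp' h))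
  simpa using this

namespace Word

theorem motzkinPath_toList (w : Word) : MotzkinPath w.toList := by
  induction w with
  | nil => simp [MotzkinPath, toList]
  | flat w ih => exact (motzkinPath_flat_iff _).2 ih
  | peak w ih => exact motzkinPath_arch (p := []) (by simp [MotzkinPath]) ih
  | arch v w ihv ihw => exact motzkinPath_arch ((motzkinPath_flat_iff _).2 ihv) ihw

theorem uuFree_toList (w : Word) : UUFree w.toList := by
  induction w with
  | nil => simp [UUFree, toList]
  | flat w ih => simpa [toList, uuFree_cons_iff] using ih
  | peak w ih => simpa [toList, uuFree_cons_iff] using ih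
  | arch v w ihv ihw =>
    simpa [toList, uuFree_cons_iff, uuFree_append_down_iff] using ⟨ihv, ihw⟩

theorem toList_injective : Function.Injective toList := by
  intro v
  induction v with
  | nil => intro w h; cases w <;> simp_all [toList]
  | flat v ih =>
    intro w h
    cases w <;> simp [toList] at h
    rw [ih h]
  | peak v ih =>
    intro w h
    cases w <;> simp [toList] at h
    rw [ih h]
  | arch u v ihu ihv =>
    intro w h
    cases w <;> simp [toList] at h
    obtain ⟨h1, h2⟩ := append_down_inj (motzkinPath_toList _) (motzkinPath_toList _) h
    rw [ihu h1, ihv h2]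

theorem exists_toList_eq (p : List ℤ) (hp : MotzkinPath p) (hu : UUFree p) :
    ∃ w : Word, w.toList = p := by
  induction hn : p.length using Nat.strong_induction_on generalizing p with
  | _ n ih =>
    subst hn
    cases p with
    | nil => exact ⟨nil, rfl⟩
    | cons a p =>
      have hu' := (uuFree_cons_iff _ _).1 hu
      rcases hp.1 a (by simp) with rfl | rfl | rfl
      · obtain ⟨q, r, rfl, hq, hr⟩ := exists_arch_of_motzkinPath hp
        have huqr := (uuFree_append_down_iff _ _).1 hu'.1
        obtain ⟨w, rfl⟩ := ih r.length (by simp; omega) r hr huqr.2 rfl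
        cases q with
        | nil => exact ⟨peak w, rfl⟩
        | cons b q =>
          rcases hq.1 b (by simp) with rfl | rfl | rfl
          · simp at hu'
          · have := hq.2.1 [-1] (by simp)
            simp at this
          · obtain ⟨v, rfl⟩ := ih q.length (by simp; omega) q ((motzkinPath_flat_iff _).1 hq)
              ((uuFree_cons_iff _ _).1 huqr.1).1 rfl
            exact ⟨arch v w, rfl⟩
      · have := hp.2.1 [-1] (by simp)
        simp at this
      · obtain ⟨w, rfl⟩ := ih p.length (by simp) p ((motzkinPath_flat_iff _).1 hp) hu'.1 rfl
        exact ⟨flat w, rfl⟩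

theorem card_length_eq_card_paths (n : ℕ) :
    Nat.card {w : Word // w.length = n} =
      Nat.card {p : List ℤ // p.length = n ∧ MotzkinPath p ∧ UUFree p} := by
  refine Nat.card_eq_of_bijective
    (fun w => ⟨w.1.toList, by rw [length_toList, w.2], motzkinPath_toList _, uuFree_toList _⟩)
    ⟨fun v w h => Subtype.ext (toList_injective (congrArg Subtype.val h)), ?_⟩
  rintro ⟨p, hn, hp, hu⟩
  obtain ⟨w, rfl⟩ := exists_toList_eq p hp hu
  exact ⟨⟨w, by rw [← hn, length_toList]⟩, rfl⟩

theorem card_length_eq_card_good (n : ℕ) :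
    Nat.card {w : Word // w.length = n} = Nat.card {t : Shape // t.size = n ∧ t.Good} := by
  refine Nat.card_eq_of_bijective
    (fun w => ⟨w.1.toShape, by rw [size_toShape, w.2], good_toShape _⟩)
    ⟨fun v w h => Subtype.ext (toShape_injective (congrArg Subtype.val h)), ?_⟩
  rintro ⟨t, hn, ht⟩
  obtain ⟨w, rfl⟩ := exists_toShape_eq t ht
  exact ⟨⟨w, by rw [← hn, size_toShape]⟩, rfl⟩

end Word

section Points

variable {α β : Type*}

/-- `S`, plotted with coordinates `x` and `y`, is the set of points `SL` up and to the left of the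
remaining points, which are `SR` and a corner `p`, where `p` is below and to the left of `SR`
if `c = true`, and above and to the right of `SR` if `c = false`. -/
structure Decomp (c : Bool) (x y : α → ℕ) (S SL SR : Finset α) (p : α) : Prop where
  mem_iff : ∀ q, q ∈ S ↔ q ∈ SL ∨ q = p ∨ q ∈ SR
  left_corner : ∀ l ∈ SL, x l < x p ∧ y p < y l
  left_right : ∀ l ∈ SL, ∀ r ∈ SR, x l < x r ∧ y r < y l
  right_corner : ∀ r ∈ SR, (c = true → x p < x r ∧ y p < y r) ∧ (c = false → x r < x p ∧ y r < y p)

/-- The point set `S`, plotted with coordinates `x` and `y`, has shape `t`. -/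
inductive Rep (c : Bool) (x y : α → ℕ) : Finset α → Shape → Prop
  | leaf {S : Finset α} : S = ∅ → Rep c x y S .leaf
  | node {S SL SR : Finset α} {p : α} {L R : Shape} : Decomp c x y S SL SR p →
      Rep c x y SL L → Rep c x y SR R → Rep c x y S (.node L R)

/-- The set of points has a restriction to small values that contains a double descent. -/
def HasDD (x y : α → ℕ) (S : Finset α) : Prop :=
  ∃ p ∈ S, ∃ q ∈ S, ∃ r ∈ S, x p < x q ∧ x q < x r ∧ y r < y q ∧ y q < y p ∧
    ∀ s ∈ S, x p < x s → x s < x r → s = q ∨ y p < y s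

/-- The set of points has a restriction to small values that ends with a descent. -/
def HasED (x y : α → ℕ) (S : Finset α) : Prop :=
  ∃ p ∈ S, ∃ q ∈ S, x p < x q ∧ y q < y p ∧ ∀ s ∈ S, x p < x s → s = q ∨ y p < y s

variable {c : Bool} {x y : α → ℕ} {S SL SR : Finset α} {p : α} {t L R : Shape}

theorem Decomp.hasED_iff (h : Decomp c x y S SL SR p) :
    HasED x y S ↔ HasED x y SR ∨ (SL.Nonempty ∧ SR = ∅) := by
  obtain ⟨hm, h1, h2, h3⟩ := h
  constructor
  · rintro ⟨a, ha, b, hb, hab, hba, H⟩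
    by_cases hR : SR = ∅
    · right
      refine ⟨?_, hR⟩
      subst hR
      rcases (hm a).1 ha with ha | rfl | ha
      · exact ⟨a, ha⟩
      · rcases (hm b).1 hb with hb | rfl | hb
        · exact ⟨b, hb⟩
        · omega
        · simp at hb
      · simp at ha
    · left
      obtain ⟨r, hr⟩ := Finset.nonempty_iff_ne_empty.2 hR
      cases c <;> simp only [HasED] <;> grind
  · rintro (⟨a, ha, b, hb, hab, hba, H⟩ | ⟨hL, rfl⟩)
    · refine ⟨a, by grind, b, by grind, hab, hba, ?_⟩
      cases c <;> grind
    · obtain ⟨a, ha, hmin⟩ := Finset.exists_min_image SL y hL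
      obtain ⟨b, hb, hmax⟩ := Finset.exists_max_image (SL.filter fun s => y s = y a) x
        ⟨a, by simp [ha]⟩
      refine ⟨b, by grind, p, by grind, by grind, by grind, ?_⟩
      grind

theorem Decomp.hasED_swap_iff (h : Decomp c x y S SL SR p) :
    HasED y x S ↔ (SL = ∅ ∧ HasED y x SR) ∨ (SL.Nonempty ∧ (HasED y x SL ∨ ∃ a, SL = {a})) := by
  classical
  obtain ⟨hm, h1, h2, h3⟩ := h
  constructor
  · rintro ⟨a, ha, b, hb, hab, hba, H⟩
    rcases SL.eq_empty_or_nonempty with hL | hL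
    · left
      subst hL
      refine ⟨rfl, a, ?_, b, ?_, hab, hba, ?_⟩ <;> cases c <;> grind
    · right
      refine ⟨hL, ?_⟩
      by_cases haL : a ∈ SL
      · left
        refine ⟨a, haL, b, ?_, hab, hba, ?_⟩ <;> grind
      · right
        refine ⟨b, ?_⟩
        obtain ⟨l, hl⟩ := hL
        have : ∀ l ∈ SL, l = b := by grind
        grind
  · rintro (⟨rfl, a, ha, b, hb, hab, hba, H⟩ | ⟨hL, ⟨a, ha, b, hb, hab, hba, H⟩ | ⟨a, rfl⟩⟩)
    · refine ⟨a, by grind, b, by grind, hab, hba, ?_⟩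
      cases c <;> grind
    · refine ⟨a, by grind, b, by grind, hab, hba, ?_⟩
      grind
    · obtain ⟨b, hb, hmax⟩ := Finset.exists_max_image (S.filter fun s => s ≠ a) y
        ⟨p, by simp; grind⟩
      refine ⟨b, by grind, a, by grind, by grind, by grind, ?_⟩
      grind

theorem Decomp.hasDD_cases (h : Decomp c x y S SL SR p)
    (hx : ∀ s ∈ S, ∀ s' ∈ S, x s = x s' → s = s') (hS : HasDD x y S) :
    HasDD x y SL ∨ HasDD x y SR ∨ (SL.Nonempty ∧ (HasED x y SL ∨ HasED y x SR)) := by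
  obtain ⟨hm, h1, h2, h3⟩ := h
  obtain ⟨a, ha, b, hb, d, hd, hab, hbd, hdb, hba, H⟩ := hS
  by_cases haL : a ∈ SL
  · by_cases hbL : b ∈ SL
    · by_cases hdL : d ∈ SL
      · exact .inl ⟨a, haL, b, hbL, d, hdL, hab, hbd, hdb, hba, by grind⟩
      · exact .inr (.inr ⟨⟨a, haL⟩, .inl ⟨a, haL, b, hbL, hab, hba, by grind⟩⟩)
    · refine .inr (.inr ⟨⟨a, haL⟩, .inr ⟨d, ?_, b, ?_, hdb, hbd, ?_⟩⟩) <;> cases c <;> grind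
  · refine .inr (.inl ⟨a, ?_, b, ?_, d, ?_, hab, hbd, hdb, hba, ?_⟩) <;> cases c <;> grind

theorem Decomp.hasDD_swap_cases (h : Decomp c x y S SL SR p)
    (hy : ∀ s ∈ S, ∀ s' ∈ S, y s = y s' → s = s') (hS : HasDD y x S) :
    HasDD y x SL ∨ HasDD y x SR ∨ (SL.Nonempty ∧ (HasED x y SL ∨ HasED y x SR)) := by
  obtain ⟨hm, h1, h2, h3⟩ := h
  obtain ⟨a, ha, b, hb, d, hd, hab, hbd, hdb, hba, H⟩ := hS
  by_cases hdL : d ∈ SL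
  · by_cases hbL : b ∈ SL
    · by_cases haL : a ∈ SL
      · exact .inl ⟨a, haL, b, hbL, d, hdL, hab, hbd, hdb, hba, by grind⟩
      · exact .inr (.inr ⟨⟨d, hdL⟩, .inl ⟨d, hdL, b, hbL, hdb, hbd, by grind⟩⟩)
    · refine .inr (.inr ⟨⟨d, hdL⟩, .inr ⟨a, ?_, b, ?_, hab, hba, ?_⟩⟩) <;> cases c <;> grind
  · refine .inr (.inl ⟨a, ?_, b, ?_, d, ?_, hab, hbd, hdb, hba, ?_⟩) <;> cases c <;> grind

theorem Decomp.hasDD_or_iff (h : Decomp c x y S SL SR p)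
    (hx : ∀ s ∈ S, ∀ s' ∈ S, x s = x s' → s = s') (hy : ∀ s ∈ S, ∀ s' ∈ S, y s = y s' → s = s') :
    HasDD x y S ∨ HasDD y x S ↔ (HasDD x y SL ∨ HasDD y x SL) ∨ (HasDD x y SR ∨ HasDD y x SR) ∨
      (SL.Nonempty ∧ (HasED x y SL ∨ HasED y x SR)) := by
  constructor
  · rintro (hS | hS)
    · have := h.hasDD_cases hx hS
      tauto
    · have := h.hasDD_swap_cases hy hS
      tauto
  · obtain ⟨hm, h1, h2, h3⟩ := h
    rintro ((⟨a, ha, b, hb, d, hd, hab, hbd, hdb, hba, H⟩ |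
      ⟨a, ha, b, hb, d, hd, hab, hbd, hdb, hba, H⟩) |
      (⟨a, ha, b, hb, d, hd, hab, hbd, hdb, hba, H⟩ |
      ⟨a, ha, b, hb, d, hd, hab, hbd, hdb, hba, H⟩) |
      ⟨⟨l, hl⟩, ⟨a, ha, b, hb, hab, hba, H⟩ | ⟨a, ha, b, hb, hab, hba, H⟩⟩)
    · exact .inl ⟨a, by grind, b, by grind, d, by grind, hab, hbd, hdb, hba, by grind⟩
    · exact .inr ⟨a, by grind, b, by grind, d, by grind, hab, hbd, hdb, hba, by grind⟩
    · refine .inl ⟨a, by grind, b, by grind, d, by grind, hab, hbd, hdb, hba, ?_⟩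
      cases c <;> grind
    · refine .inr ⟨a, by grind, b, by grind, d, by grind, hab, hbd, hdb, hba, ?_⟩
      cases c <;> grind
    · obtain ⟨d, hd, hmin⟩ := Finset.exists_min_image (S.filter fun s => y s ≤ y p) x
        ⟨p, by simp; grind⟩
      refine .inl ⟨a, by grind, b, by grind, d, by grind, hab, by grind, by grind, hba, ?_⟩
      grind
    · obtain ⟨d, hd, hmin⟩ := Finset.exists_min_image SL y ⟨l, hl⟩
      refine .inr ⟨a, by grind, b, by grind, d, by grind, hab, by grind, by grind, hba, ?_⟩
      cases c <;> grind

theorem Rep.eq_empty_iff (h : Rep c x y S t) : S = ∅ ↔ t = .leaf := by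
  cases h with
  | leaf h => simp [h]
  | node hd _ _ => simpa using Finset.ne_empty_of_mem ((hd.mem_iff _).2 (.inr (.inl rfl)))

theorem Rep.nonempty_iff (h : Rep c x y S t) : S.Nonempty ↔ t ≠ .leaf := by
  rw [Finset.nonempty_iff_ne_empty, Ne, h.eq_empty_iff]

theorem Rep.exists_eq_singleton_iff (h : Rep c x y S t) :
    (∃ a, S = {a}) ↔ t = .node .leaf .leaf := by
  cases h with
  | leaf h => simp [h]
  | @node _ SL SR p L R hd hL hR =>
    obtain ⟨hm, h1, h2, h3⟩ := hd
    rw [Shape.node.injEq, ← hL.eq_empty_iff, ← hR.eq_empty_iff]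
    constructor
    · rintro ⟨a, rfl⟩
      constructor <;> cases c <;> grind
    · rintro ⟨rfl, rfl⟩
      exact ⟨p, by grind⟩

theorem Rep.size_eq_card (h : Rep c x y S t) : t.size = S.card := by
  classical
  induction h with
  | leaf h => simp [h, Shape.size]
  | @node S SL SR p L R hd _ _ ihL ihR =>
    obtain ⟨hm, h1, h2, h3⟩ := hd
    have hp : p ∉ SL ∪ SR := by cases c <;> grind
    have hS : S = insert p (SL ∪ SR) := by grind
    rw [hS, Finset.card_insert_of_notMem hp, Finset.card_union_of_disjoint, Shape.size, ihL, ihR]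
    rw [Finset.disjoint_left]
    grind

theorem Rep.endOk_iff (h : Rep c x y S t) : t.EndOk ↔ ¬ HasED x y S := by
  induction h with
  | leaf h => simp [h, HasED, Shape.EndOk]
  | node hd hL hR _ ihR =>
    rw [hd.hasED_iff, Shape.EndOk, ihR, hL.nonempty_iff, hR.eq_empty_iff]
    tauto

theorem Rep.invEndOk_iff (h : Rep c x y S t) : t.InvEndOk ↔ ¬ HasED y x S := by
  induction h with
  | leaf h => simp [h, HasED, Shape.InvEndOk]
  | node hd hL hR ihL ihR =>
    rw [hd.hasED_swap_iff, Shape.InvEndOk, ihL, ihR, hL.nonempty_iff, hL.eq_empty_iff,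
      hL.exists_eq_singleton_iff]
    tauto

theorem Rep.good_iff (h : Rep c x y S t) (hx : ∀ s ∈ S, ∀ s' ∈ S, x s = x s' → s = s')
    (hy : ∀ s ∈ S, ∀ s' ∈ S, y s = y s' → s = s') :
    t.Good ↔ ¬ (HasDD x y S ∨ HasDD y x S) := by
  induction h with
  | leaf h => simp [h, HasDD, Shape.Good]
  | node hd hL hR ihL ihR =>
    have hm := hd.mem_iff
    rw [hd.hasDD_or_iff hx hy, Shape.Good, ihL (by grind) (by grind), ihR (by grind) (by grind),
      hL.endOk_iff, hR.invEndOk_iff, hL.nonempty_iff]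
    tauto

/-- The set of points avoids 213 if `c = true` and 132 if `c = false`. -/
def Avoids (c : Bool) (x y : α → ℕ) (S : Finset α) : Prop :=
  ∀ i ∈ S, ∀ j ∈ S, ∀ k ∈ S, x i < x j → x j < x k →
    (c = true → ¬ (y j < y i ∧ y i < y k)) ∧ (c = false → ¬ (y i < y k ∧ y k < y j))

theorem Rep.avoids (h : Rep c x y S t) : Avoids c x y S := by
  induction h with
  | leaf h => simp [h, Avoids]
  | node hd hL hR ihL ihR =>
    obtain ⟨hm, h1, h2, h3⟩ := hd
    intro i hi j hj k hk hij hjk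
    have hL := ihL i
    have hR := ihR i
    cases c <;> grind

theorem exists_rep (c : Bool) (S : Finset α) (hx : ∀ s ∈ S, ∀ s' ∈ S, x s = x s' → s = s')
    (hy : ∀ s ∈ S, ∀ s' ∈ S, y s = y s' → s = s') (hS : Avoids c x y S) :
    ∃ t, Rep c x y S t := by
  classical
  induction S using Finset.strongInduction with
  | H S ih =>
    rcases S.eq_empty_or_nonempty with rfl | hne
    · exact ⟨.leaf, .leaf rfl⟩
    obtain ⟨p, hp, SL, SR, hpL, hpR, hd⟩ : ∃ p ∈ S, ∃ SL SR : Finset α, p ∉ SL ∧ p ∉ SR ∧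
        Decomp c x y S SL SR p := by
      cases c with
      | true =>
        obtain ⟨p, hp, hmin⟩ := Finset.exists_min_image S y hne
        refine ⟨p, hp, S.filter fun s => x s < x p, S.filter fun s => x p < x s, by simp, by simp,
          ⟨by grind, by grind, ?_, by grind⟩⟩
        intro l hl r hr
        have := (hS l (by grind) p hp r (by grind) (by grind) (by grind)).1 rfl
        grind
      | false =>
        obtain ⟨p, hp, hmax⟩ := Finset.exists_max_image S x hne
        refine ⟨p, hp, S.filter fun s => y p < y s, S.filter fun s => y s < y p, by simp, by simp,
          ⟨by grind, by grind, ?_, by grind⟩⟩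
        intro l hl r hr
        by_contra hlr
        have := (hS r (by grind) l (by grind) p hp (by grind) (by grind)).2 rfl
        grind
    have hm := hd.mem_iff
    have hLs : SL ⊆ S := by grind
    have hRs : SR ⊆ S := by grind
    have hmono : ∀ T ⊆ S, p ∉ T → ∃ t, Rep c x y T t := fun T hT hpT =>
      ih T (Finset.ssubset_iff_subset_ne.2 ⟨hT, fun h => hpT (h ▸ hp)⟩)
        (fun s hs s' hs' => hx s (hT hs) s' (hT hs'))
        (fun s hs s' hs' => hy s (hT hs) s' (hT hs'))
        (fun i hi j hj k hk => hS i (hT hi) j (hT hj) k (hT hk))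
    obtain ⟨L, hL⟩ := hmono SL hLs hpL
    obtain ⟨R, hR⟩ := hmono SR hRs hpR
    exact ⟨.node L R, .node hd hL hR⟩

theorem Decomp.unique {SL' SR' : Finset α} {p' : α} (h : Decomp c x y S SL SR p)
    (h' : Decomp c x y S SL' SR' p') : SL = SL' ∧ SR = SR' := by
  obtain ⟨hm, h1, h2, h3⟩ := h
  obtain ⟨hm', h1', h2', h3'⟩ := h'
  have hp : p = p' := by cases c <;> grind
  subst hp
  constructor <;> ext q <;> cases c <;> grind

theorem Rep.unique {t' : Shape} (h : Rep c x y S t) (h' : Rep c x y S t') : t = t' := by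
  induction h generalizing t' with
  | leaf h => exact (h'.eq_empty_iff.1 h).symm
  | node hd hL hR ihL ihR =>
    cases h' with
    | leaf h => simpa [h] using (hd.mem_iff _).2 (.inr (.inl rfl))
    | node hd' hL' hR' =>
      obtain ⟨rfl, rfl⟩ := hd.unique hd'
      rw [ihL hL', ihR hR']

/-- Point sets of the same shape are order isomorphic in both coordinates. -/
theorem Rep.exists_strictMono {x' y' : α → ℕ} {S' : Finset α} (h : Rep c x y S t)
    (h' : Rep c x' y' S' t) : ∃ f : α → α, (∀ s ∈ S, f s ∈ S') ∧
      ∀ s ∈ S, ∀ s' ∈ S, (x s < x s' → x' (f s) < x' (f s')) ∧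
        (y s < y s' → y' (f s) < y' (f s')) := by
  classical
  induction h generalizing S' with
  | leaf h => exact ⟨id, by simp [h]⟩
  | @node S SL SR p L R hd hL hR ihL ihR =>
    obtain _ | @⟨_, SL', SR', p', _, _, hd', hL', hR'⟩ := h'
    obtain ⟨f, hf, hf'⟩ := ihL hL'
    obtain ⟨g, hg, hg'⟩ := ihR hR'
    obtain ⟨hm, h1, h2, h3⟩ := hd
    obtain ⟨hm', h1', h2', h3'⟩ := hd'
    refine ⟨fun s => if s ∈ SL then f s else if s ∈ SR then g s else p', by grind, ?_⟩
    intro s hs s' hs'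
    have hS := (hm s).1 hs
    have hS' := (hm s').1 hs'
    cases c <;> grind

theorem Rep.comap {x' y' : β → ℕ} {T : Finset β} (h : Rep c x y S t) (g : β → α)
    (hg : Function.Injective g) (hS : ∀ s ∈ S, ∃ b, g b = s) (hT : ∀ b, b ∈ T ↔ g b ∈ S)
    (hx : ∀ b ∈ T, x' b = x (g b)) (hy : ∀ b ∈ T, y' b = y (g b)) : Rep c x' y' T t := by
  classical
  induction h generalizing T with
  | leaf h => exact .leaf (by ext b; simp [hT, h])
  | @node S SL SR p L R hd hL hR ihL ihR =>
    obtain ⟨hm, h1, h2, h3⟩ := hd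
    obtain ⟨q, hq⟩ := hS p (by grind)
    refine .node (SL := T.filter fun b => g b ∈ SL) (SR := T.filter fun b => g b ∈ SR) (p := q)
      ⟨?_, ?_, ?_, ?_⟩ (ihL ?_ ?_ ?_ ?_) (ihR ?_ ?_ ?_ ?_)
    · intro b
      have : b = q ↔ g b = p := by rw [← hq, hg.eq_iff]
      grind
    all_goals grind

end Points

theorem exists_rep_Ico (c : Bool) (t : Shape) (a b : ℕ) : ∃ f : ℕ → ℕ,
    Rep c id f (Finset.Ico a (a + t.size)) t ∧
      (∀ i ∈ Finset.Ico a (a + t.size), f i ∈ Finset.Ico b (b + t.size)) ∧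
      ∀ i ∈ Finset.Ico a (a + t.size), ∀ j ∈ Finset.Ico a (a + t.size), f i = f j → i = j := by
  induction t generalizing a b with
  | leaf => exact ⟨id, .leaf (by simp [Shape.size]), by simp [Shape.size], by simp⟩
  | node L R ihL ihR =>
    obtain ⟨f, hf, hf', hf''⟩ := ihL a (b + R.size + 1)
    have hsize : (Shape.node L R).size = L.size + R.size + 1 := rfl
    rw [hsize]
    cases c with
    | true =>
      obtain ⟨g, hg, hg', hg''⟩ := ihR (a + L.size + 1) (b + 1)
      refine ⟨fun i => if i < a + L.size then f i else if i = a + L.size then b else g i,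
        .node (p := a + L.size) ⟨?_, ?_, ?_, ?_⟩
          (hf.comap id Function.injective_id (by simp) (fun _ => Iff.rfl) ?_ ?_)
          (hg.comap id Function.injective_id (by simp) (fun _ => Iff.rfl) ?_ ?_), ?_, ?_⟩
      all_goals simp only [Finset.mem_Ico] at *; grind
    | false =>
      obtain ⟨g, hg, hg', hg''⟩ := ihR (a + L.size) b
      refine ⟨fun i => if i < a + L.size then f i else
          if i = a + L.size + R.size then b + R.size else g i,
        .node (p := a + L.size + R.size) ⟨?_, ?_, ?_, ?_⟩
          (hf.comap id Function.injective_id (by simp) (fun _ => Iff.rfl) ?_ ?_)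
          (hg.comap id Function.injective_id (by simp) (fun _ => Iff.rfl) ?_ ?_), ?_, ?_⟩
      all_goals simp only [Finset.mem_Ico] at *; grind

variable {n : ℕ}

theorem exists_perm_rep (c : Bool) (t : Shape) (ht : t.size = n) :
    ∃ σ : Equiv.Perm (Fin n), Rep c Fin.val (fun i => (σ i).val) Finset.univ t := by
  obtain ⟨f, hf, hf', hf''⟩ := exists_rep_Ico c t 0 0
  simp only [ht, zero_add, Finset.mem_Ico, zero_le, true_and] at hf hf' hf''
  let g : Fin n → Fin n := fun i => ⟨f i, hf' i i.2⟩
  have hg : Function.Injective g := fun i j h =>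
    Fin.ext (hf'' i i.2 j j.2 (congrArg Fin.val h))
  refine ⟨Equiv.ofBijective g (Finite.injective_iff_bijective.1 hg),
    hf.comap Fin.val Fin.val_injective ?_ ?_ ?_ ?_⟩
  · intro s hs
    exact ⟨⟨s, (Finset.mem_Ico.1 hs).2⟩, rfl⟩
  · simp
  · simp
  · simp [g]

theorem perm_eq_of_rep {c : Bool} {σ τ : Equiv.Perm (Fin n)} {t : Shape}
    (hσ : Rep c Fin.val (fun i => (σ i).val) Finset.univ t)
    (hτ : Rep c Fin.val (fun i => (τ i).val) Finset.univ t) : σ = τ := by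
  obtain ⟨f, -, hf⟩ := hσ.exists_strictMono hτ
  simp only [Finset.mem_univ, true_implies, Fin.val_fin_lt] at hf
  have key : ∀ g : Fin n → Fin n, StrictMono g → g = id := fun g hg =>
    (StrictMono.range_inj hg strictMono_id).1
      (by simp [(Finite.injective_iff_surjective.1 hg.injective).range_eq])
  have h1 : f = id := key f fun i j h => (hf i j).1 h
  have h2 := key (τ ∘ f ∘ σ.symm) fun i j h => (hf (σ.symm i) (σ.symm j)).2 (by simpa using h)
  ext i
  have := congrFun h2 (σ i)
  simp only [h1, Function.comp_apply, id, Equiv.symm_apply_apply] at this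
  rw [this]

theorem simsun_iff (σ : Equiv.Perm (Fin n)) :
    Simsun σ ↔ ¬ HasDD Fin.val (fun i => (σ i).val) Finset.univ := by
  constructor
  · rintro h ⟨i, -, j, -, l, -, hij, hjl, hlj, hji, H⟩
    refine h ((σ i).val + 1) ⟨i, j, l, hij, hjl, by simp,
      by grind, by grind, hlj, hji, ?_, ?_⟩
    · intro m him hmj
      have := H m (Finset.mem_univ m) him (by omega)
      grind
    · intro m hjm hml
      have := H m (Finset.mem_univ m) (by omega) hml
      grind
  · rintro h k ⟨i, j, l, hij, hjl, hi, hj, hl, hlj, hji, H1, H2⟩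
    refine h ⟨i, Finset.mem_univ i, j, Finset.mem_univ j, l, Finset.mem_univ l, hij, hjl, hlj, hji,
      fun s _ his hsl => ?_⟩
    rcases lt_trichotomy s j with hs | hs | hs
    · exact .inr (by have := H1 s his hs; grind)
    · exact .inl hs
    · exact .inr (by have := H2 s hs hsl; grind)

theorem simsun_inv_iff (σ : Equiv.Perm (Fin n)) :
    Simsun σ⁻¹ ↔ ¬ HasDD (fun i => (σ i).val) Fin.val Finset.univ := by
  rw [simsun_iff, not_iff_not]
  constructor
  · rintro ⟨p, -, q, -, r, -, hpq, hqr, hrq, hqp, H⟩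
    refine ⟨σ⁻¹ p, Finset.mem_univ _, σ⁻¹ q, Finset.mem_univ _, σ⁻¹ r, Finset.mem_univ _,
      by simpa using hpq, by simpa using hqr, hrq, hqp, fun s _ hps hsr => ?_⟩
    have := H (σ s) (Finset.mem_univ _) (by simpa using hps) (by simpa using hsr)
    exact this.imp Equiv.Perm.eq_inv_iff_eq.2 (by simp)
  · rintro ⟨p, -, q, -, r, -, hpq, hqr, hrq, hqp, H⟩
    refine ⟨σ p, Finset.mem_univ _, σ q, Finset.mem_univ _, σ r, Finset.mem_univ _,
      hpq, hqr, by simpa using hrq, by simpa using hqp, fun s _ hps hsr => ?_⟩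
    have := H (σ⁻¹ s) (Finset.mem_univ _) (by simpa using hps) (by simpa using hsr)
    exact this.imp Equiv.Perm.inv_eq_iff_eq.1 (by simp)

theorem card_doubleSimsun_avoids (c : Bool) (n : ℕ) :
    Nat.card {σ : Equiv.Perm (Fin n) // DoubleSimsun σ ∧
        Avoids c Fin.val (fun i => (σ i).val) Finset.univ} =
      Nat.card {t : Shape // t.size = n ∧ t.Good} := by
  have hx : ∀ s ∈ Finset.univ, ∀ s' ∈ Finset.univ, (s : Fin n).val = s'.val → s = s' :=
    fun s _ s' _ => Fin.ext
  have hy : ∀ σ : Equiv.Perm (Fin n), ∀ s ∈ Finset.univ, ∀ s' ∈ Finset.univ,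
      (σ s).val = (σ s').val → s = s' := fun σ s _ s' _ h => σ.injective (Fin.ext h)
  have hgood : ∀ (σ : Equiv.Perm (Fin n)) (t : Shape),
      Rep c Fin.val (fun i => (σ i).val) Finset.univ t → (t.Good ↔ DoubleSimsun σ) := by
    intro σ t h
    rw [h.good_iff hx (hy σ), DoubleSimsun, simsun_iff, simsun_inv_iff, not_or]
  choose F hF using fun σ : {σ : Equiv.Perm (Fin n) // DoubleSimsun σ ∧
    Avoids c Fin.val (fun i => (σ i).val) Finset.univ} => exists_rep c _ hx (hy σ.1) σ.2.2
  refine Nat.card_eq_of_bijective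
    (fun σ => ⟨F σ, by simpa using (hF σ).size_eq_card, (hgood _ _ (hF σ)).2 σ.2.1⟩) ⟨?_, ?_⟩
  · intro σ τ h
    have h' : F σ = F τ := congrArg Subtype.val h
    exact Subtype.ext (perm_eq_of_rep (hF σ) (h' ▸ hF τ))
  · rintro ⟨t, hn, ht⟩
    obtain ⟨σ, hσ⟩ := exists_perm_rep c t hn
    exact ⟨⟨σ, (hgood _ _ hσ).1 ht, hσ.avoids⟩, Subtype.ext ((hF _).unique hσ)⟩

theorem avoids132_iff (σ : Equiv.Perm (Fin n)) :
    Avoids132 σ ↔ Avoids false Fin.val (fun i => (σ i).val) Finset.univ := by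
  simp [Avoids132, Avoids]
  grind

theorem avoids213_iff (σ : Equiv.Perm (Fin n)) :
    Avoids213 σ ↔ Avoids true Fin.val (fun i => (σ i).val) Finset.univ := by
  simp [Avoids213, Avoids]
  grind

end SimsunTree

/-- The 132-avoiding and 213-avoiding double simsun permutations in `S_n` are
equinumerous, both counted by the `n`-th secondary structure number (Motzkin
paths of length `n` without two consecutive up steps). -/
theorem card_doubleSimsun_avoid132_eq_avoid213 (n : ℕ) :
    Nat.card {σ : Equiv.Perm (Fin n) // DoubleSimsun σ ∧ Avoids132 σ} =
      Nat.card {σ : Equiv.Perm (Fin n) // DoubleSimsun σ ∧ Avoids213 σ} ∧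
    Nat.card {σ : Equiv.Perm (Fin n) // DoubleSimsun σ ∧ Avoids132 σ} =
      Nat.card {p : List ℤ // p.length = n ∧ MotzkinPath p ∧ UUFree p} := by
  have h132 := SimsunTree.card_doubleSimsun_avoids false n
  have h213 := SimsunTree.card_doubleSimsun_avoids true n
  simp only [← SimsunTree.avoids132_iff, ← SimsunTree.avoids213_iff] at h132 h213
  exact ⟨h132.trans h213.symm, h132.trans ((SimsunTree.Word.card_length_eq_card_good n).symm.trans
    (SimsunTree.Word.card_length_eq_card_paths n))⟩
end

section
/- For n ≥ 6, the number of 123-avoiding double simsun permutations in S_n is exactly 2; moreover there are 5 such permutations for n = 4 and 3 for n = 5. -/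
/-- The simsun property for the word `f 0, …, f (n - 1)`, with the bound `k` eliminated. -/
def SimsunWord (n : ℕ) (f : ℕ → ℕ) : Prop :=
  ∀ i j l, i < j → j < l → l < n → f l < f j → f j < f i →
    (∀ m, i < m → m < j → f i < f m) → (∀ m, j < m → m < l → f i < f m) → False

/-- `f` and `g` restrict to mutually inverse permutations of `{0, …, n - 1}`, both simsun, and
`f` avoids 123. -/
structure DoubleSimsunWord (n : ℕ) (f g : ℕ → ℕ) : Prop where
  lt : ∀ i < n, f i < n
  inv_lt : ∀ i < n, g i < n
  inv_apply : ∀ i < n, g (f i) = i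
  apply_inv : ∀ i < n, f (g i) = i
  avoids : ∀ i j k, i < j → j < k → k < n → f i < f j → f j < f k → False
  simsun : SimsunWord n f
  inv_simsun : SimsunWord n g

/-- The skew sum of increasing blocks of length 2, with the first block truncated to length 1
when `e` is odd, and the last one truncated when the parity of `n` requires it. -/
def skewPairs (e n i : ℕ) : ℕ :=
  if (i + e) % 2 = 0 then n - 2 - i else if i = 0 then n - 1 else n - i

namespace DoubleSimsunWord

variable {n : ℕ} {f g : ℕ → ℕ}

theorem inj (h : DoubleSimsunWord n f g) {i j : ℕ} (hi : i < n) (hj : j < n)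
    (hij : f i = f j) : i = j := by
  rw [← h.inv_apply i hi, ← h.inv_apply j hj, hij]

theorem pos_max (h : DoubleSimsunWord n f g) (hn : 5 ≤ n) : f 0 = n - 1 ∨ f 1 = n - 1 := by
  have hp := h.inv_lt (n - 1) (by omega)
  have hfp := h.apply_inv (n - 1) (by omega)
  generalize g (n - 1) = p at hp hfp
  have hlt : ∀ i < n, i ≠ p → f i < n - 1 := by
    intro i hi hne
    have := h.lt i hi
    have : f i ≠ n - 1 := fun h' => hne (h.inj hi hp (h'.trans hfp.symm))
    omega
  by_contra! hcon
  have hp0 : p ≠ 0 := by rintro rfl; exact hcon.1 hfp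
  have hp1 : p ≠ 1 := by rintro rfl; exact hcon.2 hfp
  have hne : ∀ i j, i < j → j < n → f i ≠ f j := fun i j hij hj h' =>
    absurd (h.inj (by omega) hj h') (by omega)
  have a01 := h.avoids 0 1 p (by omega) (by omega) hp
  have a12 := h.avoids 1 2 p (by omega)
  have n01 := hne 0 1 (by omega) (by omega)
  have n12 := hne 1 2 (by omega) (by omega)
  have l0 := hlt 0 (by omega) (by omega)
  have l1 := hlt 1 (by omega) (by omega)
  have s012 := h.simsun 0 1 2 (by omega) (by omega) (by omega)
  by_cases hp2 : p = 2
  · subst hp2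
    have l3 := hlt 3 (by omega) (by omega)
    have l4 := hlt 4 (by omega) (by omega)
    have n34 := hne 3 4 (by omega) (by omega)
    have n13 := hne 1 3 (by omega) (by omega)
    have s234 := h.simsun 2 3 4 (by omega) (by omega) (by omega)
    have s013 := h.simsun 0 1 3 (by omega) (by omega) (by omega)
    have a134 := h.avoids 1 3 4 (by omega) (by omega) (by omega)
    grind
  · have l2 := hlt 2 (by omega) (by omega)
    grind

theorem ascent_start (h : DoubleSimsunWord n f g) (hn : 6 ≤ n) (h01 : f 0 < f 1) :
    f 0 = n - 2 ∧ f 1 = n - 1 := by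
  have hne : ∀ i j, i < j → j < n → f i ≠ f j := fun i j hij hj h' =>
    absurd (h.inj (by omega) hj h') (by omega)
  have hf1 : f 1 = n - 1 := by
    have := h.pos_max (by omega)
    have := h.lt 1 (by omega)
    omega
  refine ⟨?_, hf1⟩
  have hp := h.inv_lt (n - 2) (by omega)
  have hfp := h.apply_inv (n - 2) (by omega)
  generalize g (n - 2) = q at hp hfp
  by_contra h0
  have hq0 : q ≠ 0 := by rintro rfl; exact h0 hfp
  have hq1 : q ≠ 1 := by rintro rfl; omega
  have hlt : ∀ i < n, i ≠ 1 → i ≠ q → f i < n - 2 := by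
    intro i hi hi1 hiq
    have := h.lt i hi
    have : f i ≠ n - 2 := fun h' => hiq (h.inj hi hp (h'.trans hfp.symm))
    have : f i ≠ n - 1 := fun h' => hi1 (h.inj hi (by omega) (h'.trans hf1.symm))
    omega
  have l0 := hlt 0 (by omega) (by omega) (by omega)
  have f2 := h.lt 2 (by omega)
  have n12 := hne 1 2 (by omega) (by omega)
  have n23 := hne 2 3 (by omega) (by omega)
  have n02 := hne 0 2 (by omega) (by omega)
  have s123 := h.simsun 1 2 3 (by omega) (by omega) (by omega)
  have h23 : f 2 < f 3 := by grind
  have a023 := h.avoids 0 2 3 (by omega) (by omega) (by omega)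
  have h20 : f 2 < f 0 := by grind
  have a23q := h.avoids 2 3 q (by omega)
  by_cases hq3 : q = 3
  · subst hq3
    have l4 := hlt 4 (by omega) (by omega) (by omega)
    have n45 := hne 4 5 (by omega) (by omega)
    have n24 := hne 2 4 (by omega) (by omega)
    have s345 := h.simsun 3 4 5 (by omega) (by omega) (by omega)
    have a245 := h.avoids 2 4 5 (by omega) (by omega) (by omega)
    have s024 := h.simsun 0 2 4 (by omega) (by omega) (by omega)
    grind
  · have hq2 : q ≠ 2 := by
      rintro rfl
      have n13 := hne 1 3 (by omega) (by omega)
      have f3 := h.lt 3 (by omega)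
      omega
    have l3 := hlt 3 (by omega) (by omega) (by omega)
    exact a23q (by omega) hp h23 (by omega)

/-- Removing an initial segment of positions carrying the largest values. -/
theorem drop (h : DoubleSimsunWord n f g) (d : ℕ) (hd : d ≤ n)
    (hf : ∀ i < d, n - d ≤ f i) :
    DoubleSimsunWord (n - d) (fun i => f (i + d)) (fun v => g v - d) := by
  have hg : ∀ v < n - d, d ≤ g v := by
    intro v hv
    by_contra! hlt
    have := hf _ hlt
    rw [h.apply_inv v (by omega)] at this
    omega
  have himg : ∀ i, d ≤ i → i < n → f i < n - d := by
    have hinj : Set.InjOn f (Finset.range d) := by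
      intro i hi j hj hij
      simp only [Finset.coe_range, Set.mem_Iio] at hi hj
      exact h.inj (by omega) (by omega) hij
    have hsub : (Finset.range d).image f ⊆ Finset.Ico (n - d) n := by
      intro v hv
      simp only [Finset.mem_image, Finset.mem_range, Finset.mem_Ico] at hv ⊢
      obtain ⟨i, hi, rfl⟩ := hv
      exact ⟨hf i hi, h.lt i (by omega)⟩
    have heq := Finset.eq_of_subset_of_card_le hsub (by
      rw [Finset.card_image_of_injOn hinj, Nat.card_Ico, Finset.card_range]; omega)
    intro i hdi hi
    by_contra! hle
    have hmem : f i ∈ (Finset.range d).image f := by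
      rw [heq]; exact Finset.mem_Ico.2 ⟨hle, h.lt i hi⟩
    simp only [Finset.mem_image, Finset.mem_range] at hmem
    obtain ⟨j, hj, hji⟩ := hmem
    have := h.inj (by omega) hi hji
    omega
  refine ⟨fun i hi => himg _ (by omega) (by omega), ?_, ?_, ?_, ?_, ?_, ?_⟩
  · intro i hi
    have := h.inv_lt i (by omega)
    have := hg i hi
    show g i - d < n - d
    omega
  · intro i hi
    show g (f (i + d)) - d = i
    rw [h.inv_apply _ (by omega)]
    omega
  · intro i hi
    show f (g i - d + d) = i
    rw [Nat.sub_add_cancel (hg i hi), h.apply_inv _ (by omega)]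
  · intro i j k hij hjk hk
    exact h.avoids _ _ _ (by omega) (by omega) (by omega)
  · intro i j l hij hjl hl h1 h2 h3 h4
    refine h.simsun (i + d) (j + d) (l + d) (by omega) (by omega) (by omega) h1 h2 ?_ ?_
    · intro m hm hm'
      have := h3 (m - d) (by omega) (by omega)
      simpa only [Nat.sub_add_cancel (show d ≤ m by omega)] using this
    · intro m hm hm'
      have := h4 (m - d) (by omega) (by omega)
      simpa only [Nat.sub_add_cancel (show d ≤ m by omega)] using this
  · intro i j l hij hjl hl h1 h2 h3 h4
    simp only at h1 h2 h3 h4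
    refine h.inv_simsun i j l hij hjl (by omega) (by omega) (by omega) ?_ ?_
    · intro m hm hm'
      have := h3 m hm hm'
      omega
    · intro m hm hm'
      have := h4 m hm hm'
      omega

theorem ascent_of_descent_above (h : DoubleSimsunWord n f g) {i : ℕ} (hi : i + 2 < n)
    (hlt : f (i + 1) < f i) : f (i + 1) < f (i + 2) := by
  by_contra hcon
  have hne : f (i + 1) ≠ f (i + 2) := fun h' =>
    absurd (h.inj (by omega) hi h') (by omega)
  exact h.simsun i (i + 1) (i + 2) (by omega) (by omega) hi (by omega) hlt
    (fun m _ _ => by omega) (fun m _ _ => by omega)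

/-- The permutation of `Fin n` with one-line notation `f`. -/
def toPerm (h : DoubleSimsunWord n f g) : Equiv.Perm (Fin n) where
  toFun i := ⟨f i, h.lt i i.2⟩
  invFun i := ⟨g i, h.inv_lt i i.2⟩
  left_inv i := Fin.ext (h.inv_apply i i.2)
  right_inv i := Fin.ext (h.apply_inv i i.2)

theorem toPerm_val (h : DoubleSimsunWord n f g) (i : Fin n) : (h.toPerm i).val = f i := rfl

theorem toPerm_inv_val (h : DoubleSimsunWord n f g) (i : Fin n) :
    (h.toPerm⁻¹ i).val = g i := rfl

end DoubleSimsunWord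

theorem simsun_iff {n : ℕ} (σ : Equiv.Perm (Fin n)) :
    Simsun σ ↔ ¬ ∃ i j : Fin n, i < j ∧ σ j < σ i ∧
      (∀ m : Fin n, i < m → m < j → σ i < σ m) ∧
      ∃ l : Fin n, j < l ∧ σ l < σ j ∧ ∀ m : Fin n, j < m → m < l → σ i < σ m := by
  constructor
  · rintro h ⟨i, j, hij, h2, h3, l, hjl, h1, h4⟩
    refine h ((σ i).val + 1) ⟨i, j, l, hij, hjl, ?_, ?_, ?_, h1, h2, h3, h4⟩ <;> omega
  · rintro h k ⟨i, j, l, hij, hjl, hi, hj, hl, h1, h2, h3, h4⟩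
    refine h ⟨i, j, hij, h2, fun m hm hm' => ?_, l, hjl, h1, fun m hm hm' => ?_⟩
    · have := h3 m hm hm'
      omega
    · have := h4 m hm hm'
      omega

instance {n : ℕ} : DecidablePred (Simsun (n := n)) := fun σ =>
  decidable_of_iff' _ (simsun_iff σ)

instance {n : ℕ} : DecidablePred (DoubleSimsun (n := n)) := fun _ =>
  inferInstanceAs (Decidable (_ ∧ _))

instance {n : ℕ} : DecidablePred (Avoids123 (n := n)) := fun σ =>
  decidable_of_iff (¬ ∃ i j, i < j ∧ σ i < σ j ∧ ∃ k, j < k ∧ σ j < σ k) <| by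
    unfold Avoids123
    grind

theorem simsun_iff_simsunWord {n : ℕ} (σ : Equiv.Perm (Fin n)) (f : ℕ → ℕ)
    (hf : ∀ i : Fin n, (σ i).val = f i) : Simsun σ ↔ SimsunWord n f := by
  rw [simsun_iff]
  constructor
  · intro h i j l hij hjl hl h1 h2 h3 h4
    refine h ⟨⟨i, by omega⟩, ⟨j, by omega⟩, hij, ?_, ?_, ⟨l, hl⟩, hjl, ?_, ?_⟩
    · rwa [Fin.lt_def, hf, hf]
    · intro m hm hm'
      rw [Fin.lt_def, hf, hf]
      exact h3 m hm hm'
    · rwa [Fin.lt_def, hf, hf]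
    · intro m hm hm'
      rw [Fin.lt_def, hf, hf]
      exact h4 m hm hm'
  · rintro h ⟨i, j, hij, h2, h3, l, hjl, h1, h4⟩
    simp only [Fin.lt_def, hf] at h1 h2 h3 h4
    exact h i j l hij hjl l.2 h1 h2 (fun m hm hm' => h3 ⟨m, by omega⟩ hm hm')
      (fun m hm hm' => h4 ⟨m, by omega⟩ hm hm')

theorem avoids123_iff_word {n : ℕ} (σ : Equiv.Perm (Fin n)) (f : ℕ → ℕ)
    (hf : ∀ i : Fin n, (σ i).val = f i) :
    Avoids123 σ ↔ ∀ i j k, i < j → j < k → k < n → f i < f j → f j < f k → False := by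
  constructor
  · intro h i j k hij hjk hk h1 h2
    refine h ⟨⟨i, by omega⟩, ⟨j, by omega⟩, ⟨k, hk⟩, hij, hjk, ?_, ?_⟩
    · rwa [Fin.lt_def, hf, hf]
    · rwa [Fin.lt_def, hf, hf]
  · rintro h ⟨i, j, k, hij, hjk, h1, h2⟩
    rw [Fin.lt_def, hf, hf] at h1 h2
    exact h i j k hij hjk k.2 h1 h2

theorem DoubleSimsunWord.toPerm_mem {n : ℕ} {f g : ℕ → ℕ} (h : DoubleSimsunWord n f g) :
    Avoids123 h.toPerm ∧ DoubleSimsun h.toPerm :=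
  ⟨(avoids123_iff_word _ f h.toPerm_val).2 h.avoids,
    (simsun_iff_simsunWord _ f h.toPerm_val).2 h.simsun,
    (simsun_iff_simsunWord _ g h.toPerm_inv_val).2 h.inv_simsun⟩

/-- The values of a permutation of `Fin n`, extended by `0`. -/
def permWord {n : ℕ} (σ : Equiv.Perm (Fin n)) (i : ℕ) : ℕ :=
  if h : i < n then (σ ⟨i, h⟩).val else 0

theorem val_eq_permWord {n : ℕ} (σ : Equiv.Perm (Fin n)) (i : Fin n) :
    (σ i).val = permWord σ i := by
  simp [permWord]

theorem doubleSimsunWord_permWord {n : ℕ} {σ : Equiv.Perm (Fin n)} (ha : Avoids123 σ)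
    (hs : DoubleSimsun σ) : DoubleSimsunWord n (permWord σ) (permWord σ⁻¹) where
  lt i hi := by simp [permWord, hi]
  inv_lt i hi := by simp [permWord, hi]
  inv_apply i hi := by simp [permWord, hi]
  apply_inv i hi := by simp [permWord, hi]
  avoids := (avoids123_iff_word σ _ (val_eq_permWord σ)).1 ha
  simsun := (simsun_iff_simsunWord σ _ (val_eq_permWord σ)).1 hs.1
  inv_simsun := (simsun_iff_simsunWord σ⁻¹ _ (val_eq_permWord σ⁻¹)).1 hs.2

namespace DoubleSimsunWord

variable {n : ℕ} {f g : ℕ → ℕ}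

theorem ne_of_lt (h : DoubleSimsunWord n f g) {i j : ℕ} (hij : i < j) (hj : j < n) :
    f i ≠ f j := fun h' => absurd (h.inj (by omega) hj h') (by omega)

theorem ascent_after_max (h : DoubleSimsunWord n f g) (hn : 4 ≤ n)
    (hf1 : f 1 = n - 1) : f 2 < f 3 ∧ f 2 < f 0 := by
  have f2 := h.lt 2 (by omega)
  have n12 := h.ne_of_lt (i := 1) (j := 2) (by omega) (by omega)
  have h23 : f 2 < f 3 := h.ascent_of_descent_above (i := 1) (by omega) (show f 2 < f 1 by omega)
  have n02 := h.ne_of_lt (i := 0) (j := 2) (by omega) (by omega)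
  have a023 : ¬ f 0 < f 2 := fun h02 => h.avoids 0 2 3 (by omega) (by omega) (by omega) h02 h23
  exact ⟨h23, by omega⟩

theorem four_of_ascent (h : DoubleSimsunWord 4 f g) (h01 : f 0 < f 1) :
    (f 0 = 2 ∧ f 1 = 3 ∧ f 2 = 0 ∧ f 3 = 1) ∨ (f 0 = 1 ∧ f 1 = 3 ∧ f 2 = 0 ∧ f 3 = 2) := by
  have l1 := h.lt 1 (by omega)
  have l2 := h.lt 2 (by omega)
  have l3 := h.lt 3 (by omega)
  have n03 := h.ne_of_lt (i := 0) (j := 3) (by omega) (by omega)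
  have n12 := h.ne_of_lt (i := 1) (j := 2) (by omega) (by omega)
  have n13 := h.ne_of_lt (i := 1) (j := 3) (by omega) (by omega)
  have n23 := h.ne_of_lt (i := 2) (j := 3) (by omega) (by omega)
  have n02 := h.ne_of_lt (i := 0) (j := 2) (by omega) (by omega)
  have a012 : ¬ f 1 < f 2 := h.avoids 0 1 2 (by omega) (by omega) (by omega) h01
  have a013 : ¬ f 1 < f 3 := h.avoids 0 1 3 (by omega) (by omega) (by omega) h01
  have h23 : f 2 < f 3 := h.ascent_of_descent_above (i := 1) (by omega) (show f 2 < f 1 by omega)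
  have a023 : ¬ f 0 < f 2 := fun h02 => h.avoids 0 2 3 (by omega) (by omega) (by omega) h02 h23
  omega

theorem four_of_descent (h : DoubleSimsunWord 4 f g) (h01 : f 1 < f 0) :
    (f 0 = 3 ∧ f 1 = 1 ∧ f 2 = 2 ∧ f 3 = 0) ∨ (f 0 = 1 ∧ f 1 = 0 ∧ f 2 = 3 ∧ f 3 = 2) ∨
      (f 0 = 2 ∧ f 1 = 0 ∧ f 2 = 3 ∧ f 3 = 1) := by
  have l0 := h.lt 0 (by omega)
  have l2 := h.lt 2 (by omega)
  have n02 := h.ne_of_lt (i := 0) (j := 2) (by omega) (by omega)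
  have n03 := h.ne_of_lt (i := 0) (j := 3) (by omega) (by omega)
  have n13 := h.ne_of_lt (i := 1) (j := 3) (by omega) (by omega)
  have n23 := h.ne_of_lt (i := 2) (j := 3) (by omega) (by omega)
  have h12 : f 1 < f 2 := h.ascent_of_descent_above (i := 0) (by omega) h01
  have a123 : ¬ f 2 < f 3 := h.avoids 1 2 3 (by omega) (by omega) (by omega) h12
  have s013 : ¬ (f 0 < f 2 ∧ f 3 < f 1) := fun ⟨h02, h31⟩ =>
    h.simsun 0 1 3 (by omega) (by omega) (by omega) h31 h01 (fun m _ _ => by omega)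
      (fun m _ _ => by
        obtain rfl : m = 2 := by omega
        exact h02)
  have hinv : ¬ (f 0 = 3 ∧ f 1 = 0 ∧ f 2 = 2 ∧ f 3 = 1) := by
    rintro ⟨e0, e1, e2, e3⟩
    have g1 := h.inv_apply 3 (by omega)
    have g2 := h.inv_apply 2 (by omega)
    have g3 := h.inv_apply 0 (by omega)
    rw [e3] at g1
    rw [e2] at g2
    rw [e0] at g3
    exact h.inv_simsun 1 2 3 (by omega) (by omega) (by omega) (by omega) (by omega)
      (fun m _ _ => by omega) (fun m _ _ => by omega)
  omega

theorem five_of_ascent (h : DoubleSimsunWord 5 f g) (h01 : f 0 < f 1) :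
    (f 0 = 3 ∧ f 1 = 4 ∧ f 2 = 1 ∧ f 3 = 2 ∧ f 4 = 0) ∨
      (f 0 = 2 ∧ f 1 = 4 ∧ f 2 = 0 ∧ f 3 = 3 ∧ f 4 = 1) := by
  have l1 := h.lt 1 (by omega)
  have hf1 : f 1 = 4 := by
    have := h.pos_max (by omega)
    omega
  obtain ⟨h23, h20⟩ := h.ascent_after_max (by omega) hf1
  have l3 := h.lt 3 (by omega)
  have n03 := h.ne_of_lt (i := 0) (j := 3) (by omega) (by omega)
  have n04 := h.ne_of_lt (i := 0) (j := 4) (by omega) (by omega)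
  have n13 := h.ne_of_lt (i := 1) (j := 3) (by omega) (by omega)
  have n24 := h.ne_of_lt (i := 2) (j := 4) (by omega) (by omega)
  have n34 := h.ne_of_lt (i := 3) (j := 4) (by omega) (by omega)
  have a234 : ¬ f 3 < f 4 := h.avoids 2 3 4 (by omega) (by omega) (by omega) h23
  have s024 : ¬ (f 0 < f 3 ∧ f 4 < f 2) := fun ⟨h03, h42⟩ =>
    h.simsun 0 2 4 (by omega) (by omega) (by omega) h42 h20
      (fun m _ _ => by
        obtain rfl : m = 1 := by omega
        exact h01)
      (fun m _ _ => by
        obtain rfl : m = 3 := by omega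
        exact h03)
  have hg : ∀ i v, i < 5 → f i = v → g v = i := fun i v hi hv => hv ▸ h.inv_apply i hi
  have hinv₁ : ¬ (f 0 = 3 ∧ f 2 = 0 ∧ f 3 = 2 ∧ f 4 = 1) := by
    rintro ⟨e0, e2, e3, e4⟩
    have g1 := hg 4 1 (by omega) e4
    have g2 := hg 3 2 (by omega) e3
    have g3 := hg 0 3 (by omega) e0
    exact h.inv_simsun 1 2 3 (by omega) (by omega) (by omega) (by omega) (by omega)
      (fun m _ _ => by omega) (fun m _ _ => by omega)
  have hinv₂ : ¬ (f 0 = 1 ∧ f 2 = 0 ∧ f 3 = 3 ∧ f 4 = 2) := by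
    rintro ⟨e0, e2, e3, e4⟩
    have g2 := hg 4 2 (by omega) e4
    have g3 := hg 3 3 (by omega) e3
    have g4 := hg 1 4 (by omega) hf1
    exact h.inv_simsun 2 3 4 (by omega) (by omega) (by omega) (by omega) (by omega)
      (fun m _ _ => by omega) (fun m _ _ => by omega)
  omega

theorem drop_one (h : DoubleSimsunWord n f g) (hn : 5 ≤ n) (h01 : ¬ f 0 < f 1) :
    f 0 = n - 1 ∧ DoubleSimsunWord (n - 1) (fun i => f (i + 1)) (fun v => g v - 1) ∧
      f 1 < f 2 := by
  have hf0 : f 0 = n - 1 := by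
    have := h.pos_max (by omega)
    have := h.lt 0 (by omega)
    omega
  have hd := h.drop 1 (by omega) (by intro i hi; interval_cases i; omega)
  have hlt : f 1 < n - 1 := hd.lt 0 (by omega)
  exact ⟨hf0, hd, h.ascent_of_descent_above (i := 0) (by omega) (by simpa [hf0] using hlt)⟩

theorem five_of_descent (h : DoubleSimsunWord 5 f g) (h01 : ¬ f 0 < f 1) :
    f 0 = 4 ∧ f 1 = 2 ∧ f 2 = 3 ∧ f 3 = 0 ∧ f 4 = 1 := by
  obtain ⟨hf0, hd, h12⟩ := h.drop_one (by omega) h01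
  refine ⟨hf0, (hd.four_of_ascent h12).resolve_right fun ⟨a0, a1, a2, a3⟩ => ?_⟩
  have hg : ∀ i v, i < 5 → f i = v → g v = i := fun i v hi hv => hv ▸ h.inv_apply i hi
  have g2 := hg 4 2 (by omega) a3
  have g3 := hg 2 3 (by omega) a1
  have g4 := hg 0 4 (by omega) hf0
  exact h.inv_simsun 2 3 4 (by omega) (by omega) (by omega) (by omega) (by omega)
    (fun m _ _ => by omega) (fun m _ _ => by omega)

theorem drop_two (h : DoubleSimsunWord n f g) (hn : 6 ≤ n) (h01 : f 0 < f 1) :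
    DoubleSimsunWord (n - 2) (fun i => f (i + 2)) (fun v => g v - 2) ∧ f 2 < f 3 := by
  obtain ⟨h0, h1⟩ := h.ascent_start hn h01
  have hd := h.drop 2 (by omega) (by intro i hi; interval_cases i <;> omega)
  have hlt : f 2 < n - 2 := hd.lt 0 (by omega)
  exact ⟨hd, h.ascent_of_descent_above (i := 1) (by omega) (by rw [h1]; show f 2 < _; omega)⟩

theorem eq_skewPairs_of_drop_two (h : DoubleSimsunWord n f g) (hn : 6 ≤ n) (h01 : f 0 < f 1)
    (hd : ∀ i < n - 2, f (i + 2) = skewPairs 0 (n - 2) i) :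
    ∀ i < n, f i = skewPairs 0 n i := by
  obtain ⟨h0, h1⟩ := h.ascent_start hn h01
  intro i hi
  match i with
  | 0 => simpa [skewPairs] using h0
  | 1 => simpa [skewPairs] using h1
  | i + 2 =>
    rw [hd i (by omega)]
    unfold skewPairs
    grind

theorem eq_skewPairs_of_ascent (hn : 6 ≤ n) (h : DoubleSimsunWord n f g) (h01 : f 0 < f 1) :
    ∀ i < n, f i = skewPairs 0 n i := by
  induction n using Nat.strong_induction_on generalizing f g with
  | _ n ih =>
    obtain ⟨h0, h1⟩ := h.ascent_start hn h01
    obtain ⟨hd, h23⟩ := h.drop_two hn h01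
    apply h.eq_skewPairs_of_drop_two hn h01
    by_cases hn8 : 8 ≤ n
    · exact ih (n - 2) (by omega) (by omega) hd h23
    have hg : ∀ i v, i < n → f i = v → g v = i := fun i v hi hv => hv ▸ h.inv_apply i hi
    obtain rfl | rfl : n = 6 ∨ n = 7 := by omega
    · obtain ⟨a0, a1, a2, a3⟩ | ⟨a0, a1, a2, a3⟩ := hd.four_of_ascent h23
      · intro i hi
        interval_cases i <;> assumption
      have g2 := hg 5 2 (by omega) a3
      have g3 := hg 3 3 (by omega) a1
      have g4 := hg 0 4 (by omega) h0
      exact (h.inv_simsun 2 3 4 (by omega) (by omega) (by omega) (by omega) (by omega)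
        (fun m _ _ => by omega) (fun m _ _ => by omega)).elim
    · obtain ⟨a0, a1, a2, a3, a4⟩ | ⟨a0, a1, a2, a3, a4⟩ := hd.five_of_ascent h23
      · intro i hi
        interval_cases i <;> assumption
      have g3 := hg 5 3 (by omega) a3
      have g4 := hg 3 4 (by omega) a1
      have g5 := hg 0 5 (by omega) h0
      exact (h.inv_simsun 3 4 5 (by omega) (by omega) (by omega) (by omega) (by omega)
        (fun m _ _ => by omega) (fun m _ _ => by omega)).elim

theorem eq_skewPairs (hn : 6 ≤ n) (h : DoubleSimsunWord n f g) :
    (∀ i < n, f i = skewPairs 0 n i) ∨ (∀ i < n, f i = skewPairs 1 n i) := by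
  by_cases h01 : f 0 < f 1
  · exact Or.inl (h.eq_skewPairs_of_ascent hn h01)
  right
  obtain ⟨hf0, hd, h12⟩ := h.drop_one (by omega) h01
  have htail : ∀ i < n - 1, f (i + 1) = skewPairs 0 (n - 1) i := by
    by_cases hn7 : 7 ≤ n
    · exact hd.eq_skewPairs_of_ascent (by omega) h12
    have hg : ∀ i v, i < n → f i = v → g v = i := fun i v hi hv => hv ▸ h.inv_apply i hi
    obtain rfl : n = 6 := by omega
    obtain ⟨a0, a1, a2, a3, a4⟩ | ⟨a0, a1, a2, a3, a4⟩ := hd.five_of_ascent h12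
    · intro i hi
      interval_cases i <;> assumption
    have g3 := hg 4 3 (by omega) a3
    have g4 := hg 2 4 (by omega) a1
    have g5 := hg 0 5 (by omega) hf0
    exact (h.inv_simsun 3 4 5 (by omega) (by omega) (by omega) (by omega) (by omega)
      (fun m _ _ => by omega) (fun m _ _ => by omega)).elim
  intro i hi
  match i with
  | 0 => simpa [skewPairs] using hf0
  | i + 1 =>
    rw [htail i (by omega)]
    unfold skewPairs
    grind

end DoubleSimsunWord

theorem skewPairs_lt_iff {e n i j : ℕ} (hij : i < j) (hj : j < n) :
    skewPairs e n i < skewPairs e n j ↔ j = i + 1 ∧ (i + e) % 2 = 0 := by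
  unfold skewPairs
  grind

theorem skewPairs_injOn {e n i j : ℕ} (hi : i < n) (hj : j < n)
    (h : skewPairs e n i = skewPairs e n j) : i = j := by
  unfold skewPairs at h
  grind

theorem skewPairs_lt {e n i : ℕ} (hi : i < n) : skewPairs e n i < n := by
  unfold skewPairs
  grind

theorem skewPairs_skewPairs {e n i : ℕ} (hi : i < n) :
    skewPairs (n + e) n (skewPairs e n i) = i := by
  unfold skewPairs
  grind

theorem simsunWord_skewPairs (e n : ℕ) : SimsunWord n (skewPairs e n) := by
  intro i j l hij hjl hl h1 h2 h3 h4
  have hne : ¬ skewPairs e n i < skewPairs e n j := by omega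
  have hne' : ¬ skewPairs e n j < skewPairs e n l := by omega
  rw [skewPairs_lt_iff hij (by omega)] at hne
  rw [skewPairs_lt_iff hjl (by omega)] at hne'
  have hj : j = i + 1 ∨ j = i + 2 := by
    by_contra hcon
    have := (skewPairs_lt_iff (by omega) (by omega)).1 (h3 (i + 2) (by omega) (by omega))
    omega
  have hl : l = j + 1 := by
    by_contra hcon
    have := (skewPairs_lt_iff (by omega) (by omega)).1 (h4 (j + 1) (by omega) (by omega))
    omega
  rcases hj with rfl | rfl
  · omega
  · have := (skewPairs_lt_iff (by omega) (by omega)).1 (h3 (i + 1) (by omega) (by omega))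
    omega

theorem doubleSimsunWord_skewPairs (e n : ℕ) :
    DoubleSimsunWord n (skewPairs e n) (skewPairs (n + e) n) where
  lt _ hi := skewPairs_lt hi
  inv_lt _ hi := skewPairs_lt hi
  inv_apply _ hi := skewPairs_skewPairs hi
  apply_inv i hi := skewPairs_injOn (e := n + e) (skewPairs_lt (skewPairs_lt hi)) hi
    (skewPairs_skewPairs (skewPairs_lt hi))
  avoids i j k hij hjk hk h1 h2 := by
    rw [skewPairs_lt_iff hij (by omega)] at h1
    rw [skewPairs_lt_iff hjk hk] at h2
    omega
  simsun := simsunWord_skewPairs e n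
  inv_simsun := simsunWord_skewPairs (n + e) n

theorem card_of_six_le {n : ℕ} (hn : 6 ≤ n) :
    Nat.card {σ : Equiv.Perm (Fin n) // Avoids123 σ ∧ DoubleSimsun σ} = 2 := by
  rw [Nat.card_eq_two_iff]
  refine ⟨⟨_, (doubleSimsunWord_skewPairs 0 n).toPerm_mem⟩,
    ⟨_, (doubleSimsunWord_skewPairs 1 n).toPerm_mem⟩, ?_, ?_⟩
  · intro h
    have h0 := congrArg Fin.val (Equiv.congr_fun (congrArg Subtype.val h) ⟨0, by omega⟩)
    simp only [DoubleSimsunWord.toPerm_val, skewPairs] at h0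
    grind
  · rw [Set.eq_univ_iff_forall]
    rintro ⟨σ, ha, hs⟩
    refine ((doubleSimsunWord_permWord ha hs).eq_skewPairs hn).imp ?_ ?_ <;>
    · intro h
      apply Subtype.ext
      ext i
      rw [val_eq_permWord, h i i.2]
      rfl

/-- The 123-avoiding double simsun permutations in `S_4`. -/
def avoidingDoubleSimsunFour : Finset (Equiv.Perm (Fin 4)) :=
    {⟨![2, 3, 0, 1], ![2, 3, 0, 1], by decide, by decide⟩,
     ⟨![1, 3, 0, 2], ![2, 0, 3, 1], by decide, by decide⟩,
     ⟨![3, 1, 2, 0], ![3, 1, 2, 0], by decide, by decide⟩,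
     ⟨![1, 0, 3, 2], ![1, 0, 3, 2], by decide, by decide⟩,
     ⟨![2, 0, 3, 1], ![1, 3, 0, 2], by decide, by decide⟩}

theorem card_four :
    Nat.card {σ : Equiv.Perm (Fin 4) // Avoids123 σ ∧ DoubleSimsun σ} = 5 := by
  refine (Nat.subtype_card avoidingDoubleSimsunFour fun σ => ⟨?_, ?_⟩)
    |>.trans (by decide +kernel)
  · revert σ
    decide +kernel
  · rintro ⟨ha, hs⟩
    have h := doubleSimsunWord_permWord ha hs
    have key :
      (permWord σ 0 = 2 ∧ permWord σ 1 = 3 ∧ permWord σ 2 = 0 ∧ permWord σ 3 = 1) ∨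
      (permWord σ 0 = 1 ∧ permWord σ 1 = 3 ∧ permWord σ 2 = 0 ∧ permWord σ 3 = 2) ∨
      (permWord σ 0 = 3 ∧ permWord σ 1 = 1 ∧ permWord σ 2 = 2 ∧ permWord σ 3 = 0) ∨
      (permWord σ 0 = 1 ∧ permWord σ 1 = 0 ∧ permWord σ 2 = 3 ∧ permWord σ 3 = 2) ∨
      (permWord σ 0 = 2 ∧ permWord σ 1 = 0 ∧ permWord σ 2 = 3 ∧ permWord σ 3 = 1) := by
      by_cases h01 : permWord σ 0 < permWord σ 1
      · exact (h.four_of_ascent h01).imp_right Or.inl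
      · have hne := h.ne_of_lt (i := 0) (j := 1) (by omega) (by omega)
        exact Or.inr (Or.inr (h.four_of_descent (by omega)))
    have hmem : ∀ τ ∈ avoidingDoubleSimsunFour, (∀ i : Fin 4, permWord σ i = τ i) →
        σ ∈ avoidingDoubleSimsunFour := fun τ hτ hτσ => by
      rwa [show σ = τ from Equiv.ext fun i => Fin.ext ((val_eq_permWord σ i).trans (hτσ i))]
    simp only [avoidingDoubleSimsunFour, Finset.forall_mem_insert, Finset.mem_singleton,
      forall_eq] at hmem
    obtain ⟨m0, m1, m2, m3, m4⟩ := hmem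
    rcases key with
      ⟨h0, h1, h2, h3⟩ | ⟨h0, h1, h2, h3⟩ | ⟨h0, h1, h2, h3⟩ |
      ⟨h0, h1, h2, h3⟩ | ⟨h0, h1, h2, h3⟩
    · exact m0 (by intro i; fin_cases i <;> assumption)
    · exact m1 (by intro i; fin_cases i <;> assumption)
    · exact m2 (by intro i; fin_cases i <;> assumption)
    · exact m3 (by intro i; fin_cases i <;> assumption)
    · exact m4 (by intro i; fin_cases i <;> assumption)

/-- The 123-avoiding double simsun permutations in `S_5`. -/
def avoidingDoubleSimsunFive : Finset (Equiv.Perm (Fin 5)) :=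
    {⟨![3, 4, 1, 2, 0], ![4, 2, 3, 0, 1], by decide, by decide⟩,
     ⟨![2, 4, 0, 3, 1], ![2, 4, 0, 3, 1], by decide, by decide⟩,
     ⟨![4, 2, 3, 0, 1], ![3, 4, 1, 2, 0], by decide, by decide⟩}

theorem card_five :
    Nat.card {σ : Equiv.Perm (Fin 5) // Avoids123 σ ∧ DoubleSimsun σ} = 3 := by
  refine (Nat.subtype_card avoidingDoubleSimsunFive fun σ => ⟨?_, ?_⟩)
    |>.trans (by decide +kernel)
  · revert σ
    decide +kernel
  · rintro ⟨ha, hs⟩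
    have h := doubleSimsunWord_permWord ha hs
    have key :
      (permWord σ 0 = 3 ∧ permWord σ 1 = 4 ∧ permWord σ 2 = 1 ∧ permWord σ 3 = 2 ∧ permWord σ 4 = 0) ∨
      (permWord σ 0 = 2 ∧ permWord σ 1 = 4 ∧ permWord σ 2 = 0 ∧ permWord σ 3 = 3 ∧ permWord σ 4 = 1) ∨
      (permWord σ 0 = 4 ∧ permWord σ 1 = 2 ∧ permWord σ 2 = 3 ∧ permWord σ 3 = 0 ∧ permWord σ 4 = 1) := by
      by_cases h01 : permWord σ 0 < permWord σ 1
      · exact (h.five_of_ascent h01).imp_right Or.inl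
      · have hne := h.ne_of_lt (i := 0) (j := 1) (by omega) (by omega)
        exact Or.inr (Or.inr (h.five_of_descent (by omega)))
    have hmem : ∀ τ ∈ avoidingDoubleSimsunFive, (∀ i : Fin 5, permWord σ i = τ i) →
        σ ∈ avoidingDoubleSimsunFive := fun τ hτ hτσ => by
      rwa [show σ = τ from Equiv.ext fun i => Fin.ext ((val_eq_permWord σ i).trans (hτσ i))]
    simp only [avoidingDoubleSimsunFive, Finset.forall_mem_insert, Finset.mem_singleton,
      forall_eq] at hmem
    obtain ⟨m0, m1, m2⟩ := hmem
    rcases key with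
      ⟨h0, h1, h2, h3, h4⟩ | ⟨h0, h1, h2, h3, h4⟩ | ⟨h0, h1, h2, h3, h4⟩
    · exact m0 (by intro i; fin_cases i <;> assumption)
    · exact m1 (by intro i; fin_cases i <;> assumption)
    · exact m2 (by intro i; fin_cases i <;> assumption)

/-- There are exactly 2 permutations in `S_n` (for `n ≥ 6`) that avoid 123
and are double simsun; for `n = 4` there are 5 and for `n = 5` there are 3. -/
theorem card_doubleSimsun_avoid123 :
    (∀ n : ℕ, 6 ≤ n →
      Nat.card {σ : Equiv.Perm (Fin n) // Avoids123 σ ∧ DoubleSimsun σ} = 2) ∧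
    Nat.card {σ : Equiv.Perm (Fin 4) // Avoids123 σ ∧ DoubleSimsun σ} = 5 ∧
    Nat.card {σ : Equiv.Perm (Fin 5) // Avoids123 σ ∧ DoubleSimsun σ} = 3 := by
  exact ⟨fun _ hn => card_of_six_le hn, card_four, card_five⟩
end
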